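/- Let k ≥ 3, m > k, and let I = (0 = i_0 < i_1 < ⋯ < i_{m−1}) be integers with i_1 ≥ 2. Then the Krull dimension of R/I_I^A is at least k − 2. Consequently, if m ≥ k + 2, the codimension of the Vandermonde variety Vd_{k;I}^A is strictly less than the expected codimension m − k + 1; in other words, i_1 = 1 is a necessary condition for Vd_{k;I}^A to have the expected codimension. -/

import Mathlib

open MvPolynomial

/-- The complete homogeneous symmetric polynomial of degree `d ∈ ℤ` in the variables
`x₁, …, x_k`, with the convention `h_d = 0` for `d < 0` (and `h_0 = 1`). -/
noncomputable def completeHomog (k : ℕ) (d : ℤ) : MvPolynomial (Fin k) ℂ :=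
  if 0 ≤ d then
    ∑ μ ∈ Finset.Nat.antidiagonalTuple k d.toNat, ∏ b : Fin k, (X b : MvPolynomial (Fin k) ℂ) ^ μ b
  else 0

/-- The Vandermonde ideal `I_I^A ⊆ ℂ[x₁,…,x_k]` of a pair `(k; I)`, `I = (i₀ < ⋯ < i_{m-1})`:
the ideal generated by the Jacobi–Trudi determinants `S_J` of all `k`-element subsets `J ⊆ I`. -/
noncomputable def vandermondeIdealA (k m : ℕ) (i : Fin m → ℕ) : Ideal (MvPolynomial (Fin k) ℂ) :=
  Ideal.span {p | ∃ J : Fin k → Fin m, StrictMono J ∧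
    p = Matrix.det (Matrix.of fun a b : Fin k =>
      completeHomog k ((i (J a) : ℤ) - ((k : ℤ) - 1 - (b : ℕ))))}

section CompleteHomogeneous

variable {S : Type*} [CommRing S]

theorem PowerSeries.mk_pow_mul_one_sub_C_mul_X (a : S) :
    (PowerSeries.mk fun n => a ^ n) * (1 - PowerSeries.C a * PowerSeries.X) = 1 := by
  ext n
  rw [mul_sub, mul_one, mul_left_comm, ← mul_assoc]
  cases n with
  | zero => simp
  | succ n =>
    rw [map_sub, PowerSeries.coeff_succ_mul_X, PowerSeries.coeff_C_mul]
    simp [PowerSeries.coeff_one, pow_succ']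

/-- The product of the geometric series of the `a b` is the generating function of the complete
homogeneous symmetric polynomials evaluated at `a`. -/
theorem PowerSeries.prod_mk_pow (k : ℕ) (a : Fin k → S) :
    ∏ b, (PowerSeries.mk fun n => a b ^ n) =
      PowerSeries.mk fun d => ∑ μ ∈ Finset.Nat.antidiagonalTuple k d, ∏ b, a b ^ μ b := by
  ext d
  rw [PowerSeries.coeff_prod, PowerSeries.coeff_mk]
  refine Finset.sum_bij' (fun l _ => (l : Fin k → ℕ))
    (fun μ _ => Finsupp.equivFunOnFinite.symm μ) ?_ ?_ ?_ ?_ ?_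
  · intro l hl
    simpa [Finset.Nat.mem_antidiagonalTuple, Finset.mem_finsuppAntidiag] using hl
  · intro μ hμ
    simpa [Finset.Nat.mem_antidiagonalTuple, Finset.mem_finsuppAntidiag] using hμ
  · intro l _
    ext
    simp
  · intro μ _
    simp
  · intro l _
    simp

theorem map_completeHomog {k : ℕ} (φ : MvPolynomial (Fin k) ℂ →+* S) (d : ℕ) :
    φ (completeHomog k d) =
      PowerSeries.coeff d (∏ b, (PowerSeries.mk fun n => φ (X b) ^ n)) := by
  rw [PowerSeries.prod_mk_pow, PowerSeries.coeff_mk]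
  simp [completeHomog]

theorem completeHomog_of_neg (k : ℕ) {d : ℤ} (hd : d < 0) : completeHomog k d = 0 :=
  if_neg (not_le.mpr hd)

/-- The linear recurrence satisfied by the images of the complete homogeneous symmetric
polynomials, with characteristic polynomial `∏ b, (1 - φ (X b) T)`. -/
theorem sum_coeff_mul_map_completeHomog {k n : ℕ} (φ : MvPolynomial (Fin k) ℂ →+* S)
    (p : Polynomial S) (hp : p = ∏ b, (1 - Polynomial.C (φ (X b)) * Polynomial.X))
    (hn : p.natDegree ≤ n) {d : ℤ} (hd : d ≠ 0) :
    ∑ r ∈ Finset.range (n + 1), φ (completeHomog k (d - r)) * p.coeff r = 0 := by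
  rcases lt_or_gt_of_ne hd with hd | hd
  · refine Finset.sum_eq_zero fun r _ => ?_
    rw [completeHomog_of_neg k (by omega), map_zero, zero_mul]
  lift d to ℕ using hd.le
  have key : (p : PowerSeries S) * ∏ b, (PowerSeries.mk fun n => φ (X b) ^ n) = 1 := by
    rw [hp, ← Polynomial.coeToPowerSeries.ringHom_apply, map_prod, ← Finset.prod_mul_distrib]
    refine Finset.prod_eq_one fun b _ => ?_
    rw [← PowerSeries.mk_pow_mul_one_sub_C_mul_X (φ (X b)), mul_comm]
    simp
  have h := congrArg (PowerSeries.coeff d) key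
  rw [PowerSeries.coeff_mul, PowerSeries.coeff_one, if_neg (by omega),
    Finset.Nat.sum_antidiagonal_eq_sum_range_succ_mk] at h
  rw [← h]
  have h1 : ∑ r ∈ Finset.range (n + 1), φ (completeHomog k (d - r)) * p.coeff r =
      ∑ r ∈ Finset.range (max n d + 1), φ (completeHomog k (d - r)) * p.coeff r := by
    refine Finset.sum_subset (Finset.range_subset_range.mpr (by omega)) fun r _ hr => ?_
    rw [Polynomial.coeff_eq_zero_of_natDegree_lt, mul_zero]
    simp at hr
    omega
  have h2 : ∑ r ∈ Finset.range (d + 1), φ (completeHomog k (d - r)) * p.coeff r =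
      ∑ r ∈ Finset.range (max n d + 1), φ (completeHomog k (d - r)) * p.coeff r := by
    refine Finset.sum_subset (Finset.range_subset_range.mpr (by omega)) fun r _ hr => ?_
    simp at hr
    rw [completeHomog_of_neg k (by omega), map_zero, zero_mul]
  rw [h1, ← h2]
  refine Finset.sum_congr rfl fun r hr => ?_
  simp at hr
  rw [← map_completeHomog, Polynomial.coeff_coe, mul_comm, Nat.cast_sub (by omega)]

end CompleteHomogeneous

/-- If two of the variables are sent to zero, then all Jacobi–Trudi determinants whose row indices
avoid `1` vanish. -/
theorem det_map_completeHomog_eq_zero {S : Type*} [CommRing S] [IsDomain S] {n : ℕ}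
    (φ : MvPolynomial (Fin (n + 2)) ℂ →+* S) (h0 : φ (X 0) = 0) (h1 : φ (X 1) = 0)
    (j : Fin (n + 2) → ℕ) (hj : ∀ a, j a ≠ 1) :
    φ (Matrix.det (Matrix.of fun a b : Fin (n + 2) =>
      completeHomog (n + 2) ((j a : ℤ) - (((n + 2 : ℕ) : ℤ) - 1 - (b : ℕ))))) = 0 := by
  obtain ⟨p, hp⟩ : ∃ p : Polynomial S,
    p = ∏ b : Fin (n + 2), (1 - Polynomial.C (φ (X b)) * Polynomial.X) := ⟨_, rfl⟩
  have hdeg : p.natDegree ≤ n := by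
    rw [hp, Fin.prod_univ_succ, Fin.prod_univ_succ]
    simp only [Fin.succ_zero_eq_one, h0, h1, map_zero, zero_mul, sub_zero, one_mul]
    refine (Polynomial.natDegree_prod_le _ _).trans ((Finset.sum_le_card_nsmul _ _ 1 ?_).trans ?_)
    · intro b _
      compute_degree
    · simp
  have hp0 : p.coeff 0 = 1 := by
    rw [hp, Polynomial.coeff_zero_prod]
    simp
  rw [RingHom.map_det, ← Matrix.exists_mulVec_eq_zero_iff]
  refine ⟨Fin.snoc (fun b : Fin (n + 1) => p.coeff (n - b)) 0, ?_, ?_⟩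
  · intro h
    have := congrFun h (Fin.castSucc (Fin.last n))
    rw [Fin.snoc_castSucc] at this
    simp [hp0] at this
  · ext a
    have h := sum_coeff_mul_map_completeHomog φ p hp hdeg (d := (j a : ℤ) - 1)
      (by have := hj a; omega)
    rw [← Finset.sum_range_reflect, Finset.sum_range] at h
    rw [Matrix.mulVec, dotProduct, Fin.sum_univ_castSucc]
    simp only [Fin.snoc_castSucc, Fin.snoc_last, mul_zero, add_zero, Pi.zero_apply]
    rw [← h]
    refine Finset.sum_congr rfl fun b _ => ?_
    have hb := b.isLt
    simp only [RingHom.mapMatrix_apply, Matrix.map_apply, Matrix.of_apply, Fin.val_castSucc]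
    congr 3
    omega

/-- Theorem `th:expected`: if `m > k ≥ 3` and `I = (0 = i₀ < i₁ < ⋯ < i_{m-1})` with
`i₁ ≥ 2`, then the Krull dimension of `R/I_I^A` is at least `k - 2` (so, when
`m ≥ k + 2`, the codimension of `Vd_{k;I}^A` is strictly smaller than the expected
codimension `m - k + 1`; that is, `i₁ = 1` is a necessary condition for `Vd_{k;I}^A` to
have the expected codimension). -/
theorem krullDim_ge_of_i1_ge_two (k m : ℕ) (hk : 3 ≤ k) (hkm : k < m) (i : Fin m → ℕ)
    (hi0 : i ⟨0, by omega⟩ = 0) (hmono : StrictMono i) (hi1 : 2 ≤ i ⟨1, by omega⟩) :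
    ((k - 2 : ℕ) : WithBot (WithTop ℕ)) ≤
      ringKrullDim (MvPolynomial (Fin k) ℂ ⧸ vandermondeIdealA k m i) := by
  obtain ⟨n, rfl⟩ : ∃ n, k = n + 2 := ⟨k - 2, by omega⟩
  have hi : ∀ a, i a ≠ 1 := by
    intro a
    by_cases ha : a.val = 0
    · have : a = ⟨0, by omega⟩ := Fin.ext ha
      rw [this, hi0]
      omega
    · have := hmono.monotone (show (⟨1, by omega⟩ : Fin m) ≤ a from Fin.mk_le_of_le_val (by omega))
      omega
  let φ : MvPolynomial (Fin (n + 2)) ℂ →ₐ[ℂ] MvPolynomial (Fin n) ℂ :=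
    aeval (Fin.cons 0 (Fin.cons 0 X))
  have h0 : φ (X 0) = 0 := by simp [φ]
  have h1 : φ (X 1) = 0 := by
    rw [← Fin.succ_zero_eq_one]
    simp [φ, -Fin.succ_zero_eq_one]
  have hφ : Function.Surjective φ := by
    intro q
    refine ⟨rename (fun b => b.succ.succ) q, ?_⟩
    simp only [φ, aeval_rename]
    exact aeval_X_left_apply q
  have hker : ∀ p ∈ vandermondeIdealA (n + 2) m i, φ.toRingHom p = 0 := by
    suffices vandermondeIdealA (n + 2) m i ≤ RingHom.ker φ.toRingHom from fun p hp => this hp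
    refine Ideal.span_le.mpr ?_
    rintro _ ⟨J, _, rfl⟩
    exact det_map_completeHomog_eq_zero φ.toRingHom h0 h1 (fun a => i (J a)) fun a => hi _
  refine le_trans ?_ (ringKrullDim_le_of_surjective
    (Ideal.Quotient.lift (vandermondeIdealA (n + 2) m i) φ.toRingHom hker)
    (Ideal.Quotient.lift_surjective_of_surjective _ hker hφ))
  have := ringKrullDim_add_natCard_le_ringKrullDim_mvPolynomial (R := ℂ) (Fin n)
  rw [ringKrullDim_eq_zero_of_field, zero_add, Nat.card_fin] at this
  exact this
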